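/- Each morphism in an admissible cycle M(α_{n−1}) → ⋯ → M(α₂) → M(α₁⁻¹ p αₙ⁻¹) → M(α_{n−1}) is nonzero and non-invertible, and all the modules appearing are indecomposable; hence it is a cycle in mod A. -/

import Mathlib

open scoped Classical

/-- A finite-type-free presentation of a quiver: vertices, arrows, source and target. -/
structure Quiv where
  V : Type
  E : Type
  s : E → V
  t : E → V

namespace Quiv

variable (Q : Quiv)

/-- A (composable) path, given as the list of its arrows. -/
def IsPath (l : List Q.E) : Prop := l.Chain' (fun a b => Q.t a = Q.s b)

/-- A Γ-path for the set of monomial quadratic relations `R`: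
a composable sequence of arrows each consecutive pair of which lies in `R`. -/
def GammaPath (R : Set (List Q.E)) (l : List Q.E) : Prop :=
  l.Chain' (fun a b => Q.t a = Q.s b ∧ [a, b] ∈ R)

/-- The list of arrows `l` starts at the vertex `x`. -/
def StartsAt (x : Q.V) (l : List Q.E) : Prop := ∀ h : l ≠ [], Q.s (l.head h) = x

/-- The list of arrows `l` ends at the vertex `y`. -/
def EndsAt (y : Q.V) (l : List Q.E) : Prop := ∀ h : l ≠ [], Q.t (l.getLast h) = y

/-- `l` is a path from `x` to `y` (a stationary path when `l = []`). -/
def FromTo (x y : Q.V) (l : List Q.E) : Prop :=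
  IsPath Q l ∧ StartsAt Q x l ∧ EndsAt Q y l ∧ (l = [] → x = y)

/-- An allowed path: a composable path no consecutive pair of which lies in the
set of quadratic monomial relations `R`; these are exactly the paths which are
nonzero in the quadratic monomial algebra `kQ/⟨R⟩`. -/
def Allowed (R : Set (List Q.E)) (l : List Q.E) : Prop :=
  l.Chain' (fun a b => Q.t a = Q.s b ∧ [a, b] ∉ R)

/-- The composition `u ∘_{s,r} v = α₁⋯α_{s-1} β₁⋯βₘ α_r⋯αₙ` of the paths
`u = α₁⋯αₙ` and `v = β₁⋯βₘ` at the (1-indexed) positions `s ≤ r`. -/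
def compSR (u v : List Q.E) (s r : ℕ) : List Q.E := u.take (s - 1) ++ v ++ u.drop (r - 1)

/-- The composition `u ∘_s v` at position `s`, i.e. `u ∘_{s,s+1} v`: replace the `s`-th
arrow of `u` by the path `v`. -/
def compS (u v : List Q.E) (s : ℕ) : List Q.E := u.take (s - 1) ++ v ++ u.drop s

/-- `(u,v)` is an `(s,r)` Γ-bypass. -/
def IsBypassSR (R : Set (List Q.E)) (u v : List Q.E) (s r : ℕ) : Prop :=
  1 ≤ s ∧ s ≤ r ∧ r ≤ u.length ∧ GammaPath Q R (compSR Q u v s r)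

/-- `(u,v)` is an `(s,s+1)` Γ-bypass. -/
def IsBypass (R : Set (List Q.E)) (u v : List Q.E) (s : ℕ) : Prop :=
  1 ≤ s ∧ s ≤ u.length ∧ GammaPath Q R (compS Q u v s)

end Quiv

namespace Quiv

/-- A walk in the quiver `Q`: a base vertex together with a list of letters, each letter
being an arrow together with a direction (`true` = direct letter, `false` = inverse
letter). -/
structure Walk (Q : Quiv) where
  base : Q.V
  letters : List (Q.E × Bool)

namespace Walk

/-- The endpoint of a letter. -/
def nextV (Q : Quiv) (v : Q.V) (l : Q.E × Bool) : Q.V := if l.2 then Q.t l.1 else Q.s l.1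

/-- The starting point of a letter. -/
def startV (Q : Quiv) (l : Q.E × Bool) : Q.V := if l.2 then Q.s l.1 else Q.t l.1

variable {Q : Quiv} (W : Walk Q)

/-- The `i`-th vertex of a walk (there are `length + 1` of them). -/
def vtx (i : ℕ) : Q.V := (W.letters.take i).foldl (nextV Q) W.base

/-- The walk is well-formed: each letter starts where the previous one ends. -/
def OK : Prop := ∀ i : Fin W.letters.length, startV Q (W.letters.get i) = W.vtx i

/-- The walk is reduced: no letter is immediately followed by its formal inverse. -/
def Reduced : Prop :=
  ∀ i, ∀ h : i + 1 < W.letters.length,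
    W.letters.get ⟨i + 1, h⟩ ≠
      ((W.letters.get ⟨i, by omega⟩).1, !(W.letters.get ⟨i, by omega⟩).2)

/-- The walk avoids the monomial relations `R`: no contiguous subwalk consisting of
direct letters is a path of `R`, and no contiguous subwalk consisting of inverse letters
is the reverse of a path of `R`. -/
def Avoids (R : Set (List Q.E)) : Prop :=
  ¬ ∃ i m : ℕ, 1 ≤ m ∧ i + m ≤ W.letters.length ∧
    ((((W.letters.drop i).take m).map Prod.fst ∈ R ∧
        ∀ x ∈ (W.letters.drop i).take m, x.2 = true) ∨
      ((((W.letters.drop i).take m).map Prod.fst).reverse ∈ R ∧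
        ∀ x ∈ (W.letters.drop i).take m, x.2 = false))

/-- The walk is a string for the monomial relations `R`. -/
def IsString (R : Set (List Q.E)) : Prop := W.OK ∧ W.Reduced ∧ W.Avoids R

end Walk

/-- The walk consisting of the single direct letter given by an arrow. -/
def arrowWalk (Q : Quiv) (a : Q.E) : Walk Q := ⟨Q.s a, [(a, true)]⟩

/-- The stationary walk at a vertex. -/
def trivWalk (Q : Quiv) (x : Q.V) : Walk Q := ⟨x, []⟩

/-- A representation of the quiver `Q` over the field `k` (equivalently, a module over
the path algebra; a module over `kQ/I` when the maps of the arrows of a relation of `I`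
compose to zero). -/
structure Rep (Q : Quiv) (k : Type) [Field k] where
  carrier : Q.V → Type
  [acg : ∀ v, AddCommGroup (carrier v)]
  [mod : ∀ v, Module k (carrier v)]
  map : ∀ e : Q.E, carrier (Q.s e) →ₗ[k] carrier (Q.t e)

attribute [instance] Rep.acg Rep.mod

/-- A morphism of representations. -/
structure RepHom {Q : Quiv} {k : Type} [Field k] (X Y : Rep Q k) where
  app : ∀ v, X.carrier v →ₗ[k] Y.carrier v
  comm : ∀ e : Q.E, (Y.map e).comp (app (Q.s e)) = (app (Q.t e)).comp (X.map e)

namespace RepHom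

variable {Q : Quiv} {k : Type} [Field k]

/-- Composition of morphisms of representations. -/
def comp {X Y Z : Rep Q k} (g : RepHom Y Z) (f : RepHom X Y) : RepHom X Z where
  app v := (g.app v).comp (f.app v)
  comm e := by
    rw [← LinearMap.comp_assoc, g.comm, LinearMap.comp_assoc, f.comm,
      LinearMap.comp_assoc]

/-- The identity morphism of a representation. -/
def id (X : Rep Q k) : RepHom X X where
  app v := LinearMap.id
  comm e := by simp

/-- A morphism of representations is an isomorphism when it has a two-sided inverse. -/
def IsIso {X Y : Rep Q k} (f : RepHom X Y) : Prop :=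
  ∃ g : RepHom Y X, g.comp f = RepHom.id X ∧ f.comp g = RepHom.id Y

/-- A morphism of representations is nonzero. -/
def NeZero {X Y : Rep Q k} (f : RepHom X Y) : Prop := ∃ v x, f.app v x ≠ 0

end RepHom

/-- A representation is indecomposable: it is nonzero and its only idempotent
endomorphisms are `0` and the identity. -/
def Indecomposable {Q : Quiv} {k : Type} [Field k] (X : Rep Q k) : Prop :=
  (∃ v, ∃ x : X.carrier v, x ≠ 0) ∧
    ∀ f : RepHom X X, f.comp f = f → (∀ v x, f.app v x = 0) ∨ f = RepHom.id X

/-- The string module `M(w)` of a walk `w`: at the vertex `v` it has one basis element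
for every vertex position of the walk lying at `v`, and an arrow acts by the sum of the
identity maps prescribed by the letters of the walk in which it appears. -/
noncomputable def StringMod (k : Type) [Field k] (Q : Quiv) (W : Walk Q) : Rep Q k where
  carrier v := {i : Fin (W.letters.length + 1) // W.vtx (i : ℕ) = v} → k
  map e :=
    ∑ i : Fin W.letters.length,
      ((if h : W.letters.get i = (e, true) ∧ W.vtx (i : ℕ) = Q.s e ∧
            W.vtx ((i : ℕ) + 1) = Q.t e then
          (LinearMap.single k (fun _ => k) ⟨i.succ, by simpa using h.2.2⟩).comp
            (LinearMap.proj ⟨i.castSucc, by simpa using h.2.1⟩)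
        else 0)
      + (if h : W.letters.get i = (e, false) ∧ W.vtx ((i : ℕ) + 1) = Q.s e ∧
            W.vtx (i : ℕ) = Q.t e then
          (LinearMap.single k (fun _ => k) ⟨i.castSucc, by simpa using h.2.2⟩).comp
            (LinearMap.proj ⟨i.succ, by simpa using h.2.1⟩)
        else 0))

/-- The natural "top-to-socle" morphisms between string modules: `φ` is the morphism
whose matrix has a single nonzero entry, equal to `1`, between the basis vector at the
walk position `posSrc` of the source and the one at the walk position `posTgt` of the
target. -/
def IsEntryMap {Q : Quiv} {k : Type} [Field k] (Wb Wa : Walk Q) (posSrc posTgt : ℕ)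
    (φ : RepHom (StringMod k Q Wb) (StringMod k Q Wa)) : Prop :=
  ∀ v (x : (StringMod k Q Wb).carrier v) jp, φ.app v x jp =
    if (jp.1 : ℕ) = posTgt then
      (∑ ip, if (ip.1 : ℕ) = posSrc then x ip else 0)
    else 0

end Quiv

namespace Quiv

/-- The walk `a⁻¹ p z⁻¹` obtained by concatenating the inverse of the arrow `a`, the
(direct) path `p`, and the inverse of the arrow `z`; for `u = α₁⋯αₙ` and `a = α₁`,
`z = αₙ`, this is the walk `α₁⁻¹ p αₙ⁻¹` underlying the non-uniserial module of an
admissible cycle. -/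
def bigWalk (Q : Quiv) (a z : Q.E) (p : List Q.E) : Walk Q :=
  ⟨Q.t a, (a, false) :: (p.map (fun b => (b, true)) ++ [(z, false)])⟩

/-- The walk underlying the string module `M(p)` of a (direct) path `p` from `x`. -/
def pathWalk (Q : Quiv) (x : Q.V) (p : List Q.E) : Walk Q :=
  ⟨x, p.map (fun b => (b, true))⟩

/-- The walk `p z⁻¹` obtained by concatenating the (direct) path `p` from `x` and the
inverse of the arrow `z`. -/
def pathInvWalk (Q : Quiv) (x : Q.V) (p : List Q.E) (z : Q.E) : Walk Q :=
  ⟨x, p.map (fun b => (b, true)) ++ [(z, false)]⟩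

/-- The data `(u, p)` of a reduced basic cochain `χ^p_u`: `u` is a Γ-path from `x` to
`y`, `p` is a parallel path which is nonzero in `A` (i.e. avoids the relations), `p` does
not start with the first arrow of `u` and does not end with the last arrow of `u`. -/
def IsReducedBasic (Q : Quiv) (R : Set (List Q.E)) (x y : Q.V) (u p : List Q.E) : Prop :=
  Q.GammaPath R u ∧ Q.FromTo x y u ∧ Q.Allowed R p ∧ Q.FromTo x y p ∧
    (∀ (hp : p ≠ []) (hu : u ≠ []), p.head hp ≠ u.head hu) ∧
    (∀ (hp : p ≠ []) (hu : u ≠ []), p.getLast hp ≠ u.getLast hu)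

end Quiv

namespace Quiv

/-- The `j`-th walk (cyclically) of the admissible cycle `C(u,p)` associated with a
reduced basic cochain `χ^p_u`, `u` of length `n ≥ 2`: the cycle
`M(α₁⁻¹pαₙ⁻¹) → M(α_{n-1}) → M(α_{n-2}) → ⋯ → M(α₂) → M(α₁⁻¹pαₙ⁻¹)` has period `n-1`,
position `0` carrying the walk `α₁⁻¹ p αₙ⁻¹` and position `j` (for `1 ≤ j ≤ n-2`)
carrying the one-arrow walk of `α_{n-j}`. -/
def cycWalk (Q : Quiv) (u p : List Q.E) (hu : u ≠ []) (n j : ℕ) : Walk Q :=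
  if j % (n - 1) = 0 then bigWalk Q (u.head hu) (u.getLast hu) p
  else arrowWalk Q (u.getD (n - 1 - (j % (n - 1))) (u.head hu))

/-- The position, in the `j`-th walk of the admissible cycle, of the top basis vector
through which the `j`-th natural morphism of the cycle factors. -/
def cycPosSrc (Q : Quiv) (p : List Q.E) (n j : ℕ) : ℕ :=
  if j % (n - 1) = 0 then p.length + 2 else 0

/-- The position, in the `(j+1)`-st walk of the admissible cycle, of the socle basis
vector through which the `j`-th natural morphism of the cycle factors. -/
def cycPosTgt (Q : Quiv) (n j : ℕ) : ℕ := if (j + 1) % (n - 1) = 0 then 0 else 1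

end Quiv

namespace Quiv

section IdempotentMatrix

variable {ι k : Type*} [Fintype ι] [Field k]

/-- An idempotent strictly triangular matrix is zero. -/
theorem matrix_eq_zero_of_idempotent_of_strictly_triangular (M : Matrix ι ι k) (ρ : ι → ℕ)
    (hM : M * M = M) (hρ : ∀ i j, M i j ≠ 0 → ρ i < ρ j) : M = 0 := by
  have key : ∀ d i j, ρ j - ρ i ≤ d → M i j = 0 := by
    intro d
    induction d with
    | zero =>
      intro i j h
      by_contra hne
      have := hρ i j hne
      omega
    | succ d ih =>
      intro i j h
      rw [← hM, Matrix.mul_apply]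
      refine Finset.sum_eq_zero fun l _ => ?_
      by_contra hne
      have h1 := hρ i l (left_ne_zero_of_mul hne)
      have h2 := hρ l j (right_ne_zero_of_mul hne)
      exact left_ne_zero_of_mul hne (ih i l (by omega))
  ext i j
  exact key _ i j le_rfl

/-- An idempotent triangular matrix with constant diagonal is zero or the identity. -/
theorem matrix_eq_zero_or_one_of_idempotent_of_triangular [DecidableEq ι]
    (M : Matrix ι ι k) (ρ : ι → ℕ) (c : k) (i₀ : ι) (hM : M * M = M) (hρ : ∀ i j, i ≠ j → M i j ≠ 0 → ρ i < ρ j)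
    (hc : ∀ i, M i i = c) : M = 0 ∨ M = 1 := by
  have hcc : c * c = c := by
    have h := congrFun (congrFun hM i₀) i₀
    rw [Matrix.mul_apply, Finset.sum_eq_single i₀, hc] at h
    · exact h
    · intro l _ hl
      by_contra hne
      have h1 := hρ i₀ l hl.symm (left_ne_zero_of_mul hne)
      have h2 := hρ l i₀ hl (right_ne_zero_of_mul hne)
      omega
    · simp
  rcases IsIdempotentElem.iff_eq_zero_or_one.mp hcc with h0 | h1
  · left
    refine matrix_eq_zero_of_idempotent_of_strictly_triangular M ρ hM fun i j hij => ?_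
    refine hρ i j ?_ hij
    rintro rfl
    exact hij ((hc i).trans h0)
  · right
    have : (1 : Matrix ι ι k) - M = 0 := by
      refine matrix_eq_zero_of_idempotent_of_strictly_triangular (1 - M) ρ
        (IsIdempotentElem.one_sub hM) fun i j hij => ?_
      by_cases h : i = j
      · subst h
        simp [hc, h1] at hij
      · refine hρ i j h ?_
        simpa [Matrix.one_apply_ne h] using hij
    exact (sub_eq_zero.mp this).symm

end IdempotentMatrix

namespace Walk

variable {Q : Quiv}

/-- In the string module of `W`, the arrow `e` carries the basis vector at position `i` to the
one at position `j`. -/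
def Step (W : Walk Q) (e : Q.E) (i j : ℕ) : Prop :=
  (W.letters[i]? = some (e, true) ∧ j = i + 1) ∨ (W.letters[j]? = some (e, false) ∧ i = j + 1)

/-- The positions of a walk lying at a given vertex. -/
abbrev Pos (W : Walk Q) (v : Q.V) : Type :=
  {i : Fin (W.letters.length + 1) // W.vtx (i : ℕ) = v}

theorem vtx_succ (W : Walk Q) {i : ℕ} {l : Q.E × Bool} (h : W.letters[i]? = some l) :
    W.vtx (i + 1) = if l.2 then Q.t l.1 else Q.s l.1 := by
  simp [vtx, List.take_add_one, h, nextV]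

theorem OK.startV_eq {W : Walk Q} (hW : W.OK) {i : ℕ} {l : Q.E × Bool}
    (h : W.letters[i]? = some l) : W.vtx i = if l.2 then Q.s l.1 else Q.t l.1 := by
  obtain ⟨hi, rfl⟩ := List.getElem?_eq_some_iff.mp h
  simpa [startV] using (hW ⟨i, hi⟩).symm

theorem Step.le_length {W : Walk Q} {e : Q.E} {i j : ℕ} (h : W.Step e i j) :
    i ≤ W.letters.length ∧ j ≤ W.letters.length := by
  rcases h with ⟨h, rfl⟩ | ⟨h, rfl⟩ <;>
  · have := (List.getElem?_eq_some_iff.mp h).1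
    omega

theorem OK.vtx_of_step {W : Walk Q} (hW : W.OK) {e : Q.E} {i j : ℕ} (h : W.Step e i j) :
    W.vtx i = Q.s e ∧ W.vtx j = Q.t e := by
  rcases h with ⟨h, rfl⟩ | ⟨h, rfl⟩ <;>
    simp [hW.startV_eq h, W.vtx_succ h]

theorem Reduced.ne {W : Walk Q} (hW : W.Reduced) {i : ℕ} {e : Q.E} {b : Bool}
    (h : W.letters[i]? = some (e, b)) : W.letters[i + 1]? ≠ some (e, !b) := by
  intro h'
  obtain ⟨hi, h⟩ := List.getElem?_eq_some_iff.mp h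
  obtain ⟨hi', h'⟩ := List.getElem?_eq_some_iff.mp h'
  apply hW i hi'
  simp [h, h']

theorem Reduced.step_right_unique {W : Walk Q} (hW : W.Reduced) {e : Q.E} {i j j' : ℕ}
    (h : W.Step e i j) (h' : W.Step e i j') : j = j' := by
  rcases h with ⟨h, rfl⟩ | ⟨h, hi⟩ <;> rcases h' with ⟨h', rfl⟩ | ⟨h', hi'⟩
  · rfl
  · subst hi'
    exact absurd h (hW.ne h')
  · subst hi
    exact absurd h' (hW.ne h)
  · omega

theorem Reduced.step_left_unique {W : Walk Q} (hW : W.Reduced) {e : Q.E} {i i' j : ℕ}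
    (h : W.Step e i j) (h' : W.Step e i' j) : i = i' := by
  rcases h with ⟨h, hj⟩ | ⟨h, rfl⟩ <;> rcases h' with ⟨h', hj'⟩ | ⟨h', rfl⟩
  · omega
  · subst hj
    exact absurd h' (hW.ne h)
  · subst hj'
    exact absurd h (hW.ne h')
  · rfl

end Walk

section StringModules

open Walk

variable {Q : Quiv} {k : Type} [Field k]

/-- The action of an arrow on a string module, with the underlying function spaces explicit. -/
noncomputable def strMap (k : Type) [Field k] (W : Walk Q) (e : Q.E) :
    (W.Pos (Q.s e) → k) →ₗ[k] (W.Pos (Q.t e) → k) :=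
  (StringMod k Q W).map e

theorem strMap_apply (W : Walk Q) (e : Q.E) (x : W.Pos (Q.s e) → k) (j : W.Pos (Q.t e)) :
    strMap k W e x j = ∑ i, if W.Step e i.1 j.1 then x i else 0 := by
  have hstep : ∀ i : W.Pos (Q.s e), (if W.Step e i.1 j.1 then x i else 0) =
      ∑ l : Fin W.letters.length,
        ((if W.letters.get l = (e, true) ∧ i.1 = l.castSucc ∧ j.1 = l.succ then x i else 0) +
        (if W.letters.get l = (e, false) ∧ i.1 = l.succ ∧ j.1 = l.castSucc then x i else 0)) := by
    intro i
    rw [Finset.sum_add_distrib]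
    have h1 : (∑ l : Fin W.letters.length,
        if W.letters.get l = (e, true) ∧ i.1 = l.castSucc ∧ j.1 = l.succ then x i else 0) =
        if W.letters[(i.1 : ℕ)]? = some (e, true) ∧ (j.1 : ℕ) = i.1 + 1 then x i else 0 := by
      split_ifs with h
      · obtain ⟨hl, he⟩ := List.getElem?_eq_some_iff.mp h.1
        rw [Finset.sum_eq_single ⟨i.1, hl⟩]
        · simp [Fin.ext_iff, he, h.2]
        · intro l _ hl'
          rw [if_neg]
          rintro ⟨-, hi, -⟩
          exact hl' (Fin.ext (by simp [hi]))
        · simp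
      · refine Finset.sum_eq_zero fun l _ => if_neg ?_
        rintro ⟨he, hi, hj⟩
        exact h (by simp [hi, hj, ← he])
    have h2 : (∑ l : Fin W.letters.length,
        if W.letters.get l = (e, false) ∧ i.1 = l.succ ∧ j.1 = l.castSucc then x i else 0) =
        if W.letters[(j.1 : ℕ)]? = some (e, false) ∧ (i.1 : ℕ) = j.1 + 1 then x i else 0 := by
      split_ifs with h
      · obtain ⟨hl, he⟩ := List.getElem?_eq_some_iff.mp h.1
        rw [Finset.sum_eq_single ⟨j.1, hl⟩]
        · simp [Fin.ext_iff, he, h.2]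
        · intro l _ hl'
          rw [if_neg]
          rintro ⟨-, -, hj⟩
          exact hl' (Fin.ext (by simp [hj]))
        · simp
      · refine Finset.sum_eq_zero fun l _ => if_neg ?_
        rintro ⟨he, hi, hj⟩
        exact h (by simp [hi, hj, ← he])
    rw [h1, h2]
    have hS : W.Step e i.1 j.1 ↔ (W.letters[(i.1 : ℕ)]? = some (e, true) ∧ (j.1 : ℕ) = i.1 + 1) ∨
        (W.letters[(j.1 : ℕ)]? = some (e, false) ∧ (i.1 : ℕ) = j.1 + 1) := Iff.rfl
    by_cases ha : (j.1 : ℕ) = i.1 + 1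
    · have hb : ¬ (i.1 : ℕ) = j.1 + 1 := by omega
      refine Eq.trans ?_ (congrArg _ (if_neg fun h => hb h.2)).symm
      rw [add_zero]
      exact if_congr (hS.trans (or_iff_left fun h => hb h.2)) rfl rfl
    · refine Eq.trans ?_ (congrArg (· + _) (if_neg fun h => ha h.2)).symm
      rw [zero_add]
      exact if_congr (hS.trans (or_iff_right fun h => ha h.2)) rfl rfl
  simp_rw [hstep]
  rw [Finset.sum_comm, strMap]
  simp only [StringMod]
  rw [LinearMap.sum_apply, Finset.sum_apply]
  refine Finset.sum_congr rfl fun l _ => ?_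
  rw [LinearMap.add_apply, Pi.add_apply, Finset.sum_add_distrib]
  obtain ⟨j, hj⟩ := j
  congr 1
  · split_ifs with h
    · rw [Finset.sum_eq_single ⟨l.castSucc, by simpa using h.2.1⟩]
      · by_cases hjl : j = l.succ
        · subst hjl
          simp [show W.letters[(l : ℕ)] = _ from h.1]
        · simp [hjl]
      · intro b _ hb
        rw [if_neg]
        rintro ⟨-, hb', -⟩
        exact hb (Subtype.ext hb')
      · simp
    · refine (Finset.sum_eq_zero fun i _ => if_neg ?_).symm
      rintro ⟨he, hi, hj'⟩
      refine h ⟨he, ?_, ?_⟩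
      · rw [← i.2, hi]; rfl
      · rw [← hj, show j = _ from hj']; rfl
  · split_ifs with h
    · rw [Finset.sum_eq_single ⟨l.succ, by simpa using h.2.1⟩]
      · by_cases hjl : j = l.castSucc
        · subst hjl
          simp [show W.letters[(l : ℕ)] = _ from h.1]
        · simp [hjl]
      · intro b _ hb
        rw [if_neg]
        rintro ⟨-, hb', -⟩
        exact hb (Subtype.ext hb')
      · simp
    · refine (Finset.sum_eq_zero fun i _ => if_neg ?_).symm
      rintro ⟨he, hi, hj'⟩
      refine h ⟨he, ?_, ?_⟩
      · rw [← i.2, hi]; rfl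
      · rw [← hj, show j = _ from hj']; rfl

/-- A morphism of string modules at a vertex, with the underlying function spaces explicit. -/
def homApp {W W' : Walk Q} (f : RepHom (StringMod k Q W) (StringMod k Q W')) (v : Q.V) :
    (W.Pos v → k) →ₗ[k] (W'.Pos v → k) :=
  f.app v

theorem homApp_strMap {W W' : Walk Q} (f : RepHom (StringMod k Q W) (StringMod k Q W'))
    (e : Q.E) (x : W.Pos (Q.s e) → k) :
    homApp f (Q.t e) (strMap k W e x) = strMap k W' e (homApp f (Q.s e) x) :=
  (LinearMap.congr_fun (f.comm e) x).symm

/-- The matrix coefficient of an endomorphism of a string module at two positions of the walk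
(zero if these are not positions at a common vertex). -/
noncomputable def coeff {W : Walk Q} (f : RepHom (StringMod k Q W) (StringMod k Q W))
    (i j : ℕ) : k :=
  if h : i < W.letters.length + 1 ∧ j < W.letters.length + 1 ∧ W.vtx i = W.vtx j then
    homApp f (W.vtx j) (Pi.single ⟨⟨i, h.1⟩, h.2.2⟩ 1) ⟨⟨j, h.2.1⟩, rfl⟩
  else 0

theorem homApp_single {W : Walk Q} (f : RepHom (StringMod k Q W) (StringMod k Q W)) {v : Q.V}
    (i j : W.Pos v) : homApp f v (Pi.single i 1) j = coeff f i.1 j.1 := by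
  obtain ⟨j, rfl⟩ := j
  rw [coeff, dif_pos ⟨i.1.2, j.2, i.2⟩]

theorem homApp_apply {W : Walk Q} (f : RepHom (StringMod k Q W) (StringMod k Q W)) {v : Q.V}
    (x : W.Pos v → k) (j : W.Pos v) : homApp f v x j = ∑ i, x i * coeff f i.1 j.1 := by
  conv_lhs => rw [pi_eq_sum_univ' x]
  simp [map_sum, Finset.sum_apply, ← homApp_single]

theorem coeff_eq_zero_of_vtx_ne {W : Walk Q} (f : RepHom (StringMod k Q W) (StringMod k Q W))
    {i j : ℕ} (h : W.vtx i ≠ W.vtx j) : coeff f i j = 0 :=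
  dif_neg fun h' => h h'.2.2

theorem coeff_comm {W : Walk Q} (f : RepHom (StringMod k Q W) (StringMod k Q W)) (e : Q.E)
    (i : W.Pos (Q.s e)) (j : W.Pos (Q.t e)) :
    (∑ i' : W.Pos (Q.t e), if W.Step e i.1 i'.1 then coeff f i'.1 j.1 else 0) =
      ∑ j' : W.Pos (Q.s e), if W.Step e j'.1 j.1 then coeff f i.1 j'.1 else 0 := by
  have h := congrFun (homApp_strMap f e (Pi.single i 1)) j
  rw [strMap_apply, homApp_apply] at h
  simp only [homApp_single] at h
  rw [← h]
  refine Finset.sum_congr rfl fun i' _ => ?_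
  rw [strMap_apply, Finset.sum_eq_single i]
  · simp
  · intro b _ hb
    simp [hb]
  · simp

theorem coeff_eq_of_step {W : Walk Q} (hW : W.OK) (hr : W.Reduced)
    (f : RepHom (StringMod k Q W) (StringMod k Q W)) {e : Q.E} {i i' j j' : ℕ}
    (hi : W.Step e i i') (hj : W.Step e j j') : coeff f i j = coeff f i' j' := by
  have h := coeff_comm f e ⟨⟨i, by have := hi.le_length; omega⟩, (hW.vtx_of_step hi).1⟩
    ⟨⟨j', by have := hj.le_length; omega⟩, (hW.vtx_of_step hj).2⟩
  rw [Finset.sum_eq_single ⟨⟨i', by have := hi.le_length; omega⟩, (hW.vtx_of_step hi).2⟩,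
    Finset.sum_eq_single ⟨⟨j, by have := hj.le_length; omega⟩, (hW.vtx_of_step hj).1⟩,
    if_pos hi, if_pos hj] at h
  · exact h.symm
  · intro b _ hb
    refine if_neg fun hs => hb ?_
    exact Subtype.ext (Fin.ext (hr.step_left_unique hs hj))
  · simp
  · intro b _ hb
    refine if_neg fun hs => hb ?_
    exact Subtype.ext (Fin.ext (hr.step_right_unique hs hi))
  · simp

theorem coeff_eq_zero_of_not_step_left {W : Walk Q} (hW : W.OK) (hr : W.Reduced)
    (f : RepHom (StringMod k Q W) (StringMod k Q W)) {e : Q.E} {i i' j' : ℕ}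
    (hi : W.Step e i i') (hj : ∀ j, ¬ W.Step e j j') : coeff f i' j' = 0 := by
  by_contra hne
  have hd : i' < W.letters.length + 1 ∧ j' < W.letters.length + 1 ∧ W.vtx i' = W.vtx j' := by
    by_contra h
    exact hne (dif_neg h)
  have h := coeff_comm f e ⟨⟨i, by have := hi.le_length; omega⟩, (hW.vtx_of_step hi).1⟩
    ⟨⟨j', hd.2.1⟩, hd.2.2.symm.trans (hW.vtx_of_step hi).2⟩
  rw [Finset.sum_eq_single ⟨⟨i', hd.1⟩, (hW.vtx_of_step hi).2⟩, if_pos hi,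
    Finset.sum_eq_zero fun b _ => if_neg (hj _)] at h
  · exact hne h
  · intro b _ hb
    refine if_neg fun hs => hb ?_
    exact Subtype.ext (Fin.ext (hr.step_right_unique hs hi))
  · simp

theorem coeff_eq_zero_of_not_step_right {W : Walk Q} (hW : W.OK) (hr : W.Reduced)
    (f : RepHom (StringMod k Q W) (StringMod k Q W)) {e : Q.E} {i j j' : ℕ}
    (hj : W.Step e j j') (hi : ∀ i', ¬ W.Step e i i') : coeff f i j = 0 := by
  by_contra hne
  have hd : i < W.letters.length + 1 ∧ j < W.letters.length + 1 ∧ W.vtx i = W.vtx j := by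
    by_contra h
    exact hne (dif_neg h)
  have h := coeff_comm f e ⟨⟨i, hd.1⟩, hd.2.2.trans (hW.vtx_of_step hj).1⟩
    ⟨⟨j', by have := hj.le_length; omega⟩, (hW.vtx_of_step hj).2⟩
  rw [Finset.sum_eq_zero fun b _ => if_neg (hi _),
    Finset.sum_eq_single ⟨⟨j, hd.2.1⟩, (hW.vtx_of_step hj).1⟩, if_pos hj] at h
  · exact hne h.symm
  · intro b _ hb
    refine if_neg fun hs => hb ?_
    exact Subtype.ext (Fin.ext (hr.step_left_unique hs hj))
  · simp

theorem coeff_self {W : Walk Q} (hW : W.OK) (hr : W.Reduced)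
    (f : RepHom (StringMod k Q W) (StringMod k Q W)) {i : ℕ} (hi : i ≤ W.letters.length) :
    coeff f i i = coeff f 0 0 := by
  induction i with
  | zero => rfl
  | succ i ih =>
    rw [← ih (by omega)]
    obtain ⟨⟨e, b⟩, he⟩ : ∃ l, W.letters[i]? = some l :=
      ⟨_, List.getElem?_eq_getElem (by omega)⟩
    cases b
    · have hs : W.Step e (i + 1) i := Or.inr ⟨he, rfl⟩
      exact coeff_eq_of_step hW hr f hs hs
    · have hs : W.Step e i (i + 1) := Or.inl ⟨he, rfl⟩
      exact (coeff_eq_of_step hW hr f hs hs).symm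

theorem coeff_comp {W : Walk Q} (f g : RepHom (StringMod k Q W) (StringMod k Q W))
    (i j : Fin (W.letters.length + 1)) :
    coeff (g.comp f) i j = ∑ l : Fin (W.letters.length + 1), coeff f i l * coeff g l j := by
  by_cases hv : W.vtx i = W.vtx j
  · have h : coeff (g.comp f) i j =
        homApp g (W.vtx j) (homApp f (W.vtx j) (Pi.single ⟨i, hv⟩ 1)) ⟨j, rfl⟩ :=
      (homApp_single (g.comp f) (v := W.vtx j) ⟨i, hv⟩ ⟨j, rfl⟩).symm
    rw [h, homApp_apply]
    simp only [homApp_single]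
    refine Finset.sum_bij_ne_zero (fun l _ _ => l.1) (by simp)
      (fun _ _ _ _ _ _ h => Subtype.ext h) ?_ (by simp)
    intro l _ hl
    have hlj : W.vtx l = W.vtx j := by
      by_contra hne
      exact right_ne_zero_of_mul hl (coeff_eq_zero_of_vtx_ne g hne)
    exact ⟨⟨l, hlj⟩, by simp, hl, rfl⟩
  · rw [coeff_eq_zero_of_vtx_ne _ hv]
    refine (Finset.sum_eq_zero fun l _ => ?_).symm
    by_cases hil : W.vtx i = W.vtx l
    · rw [coeff_eq_zero_of_vtx_ne g fun h => hv (hil.trans h), mul_zero]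
    · rw [coeff_eq_zero_of_vtx_ne f hil, zero_mul]

/-- A string module whose endomorphisms are all triangular with respect to a fixed ranking of
the positions of the walk is indecomposable. -/
theorem indecomposable_of_triangular {W : Walk Q} (hW : W.OK) (hr : W.Reduced) (ρ : ℕ → ℕ)
    (hρ : ∀ (f : RepHom (StringMod k Q W) (StringMod k Q W)) (i j : ℕ), i ≤ W.letters.length →
      j ≤ W.letters.length → i ≠ j → coeff f i j ≠ 0 → ρ i < ρ j) :
    Indecomposable (StringMod k Q W) := by
  refine ⟨⟨W.vtx 0, fun _ => (1 : k), fun h => one_ne_zero (congrFun h ⟨0, rfl⟩)⟩, fun f hf => ?_⟩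
  let M : Matrix (Fin (W.letters.length + 1)) (Fin (W.letters.length + 1)) k :=
    fun i j => coeff f i j
  have hM : M * M = M := by
    ext i j
    rw [Matrix.mul_apply]
    exact (coeff_comp f f i j).symm.trans (by rw [hf])
  rcases matrix_eq_zero_or_one_of_idempotent_of_triangular M (fun i => ρ i) (coeff f 0 0) 0 hM
    (fun i j hij h => hρ f i j (by omega) (by omega) (by omega) h)
    (fun i => coeff_self hW hr f (by omega)) with h | h
  · left
    intro v x
    refine funext fun j => (homApp_apply f x j).trans (Finset.sum_eq_zero fun i _ => ?_)
    rw [show coeff f i.1 j.1 = 0 from congrFun (congrFun h i.1) j.1, mul_zero]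
  · right
    have happ : f.app = (RepHom.id (StringMod k Q W)).app := by
      funext v
      refine LinearMap.ext fun x => funext fun j => (homApp_apply f x j).trans ?_
      rw [Finset.sum_eq_single j]
      · rw [show coeff f j.1 j.1 = 1 by
          simpa using congrFun (congrFun h j.1) j.1, mul_one]
        rfl
      · intro i _ hij
        rw [show coeff f i.1 j.1 = 0 by
          simpa [Matrix.one_apply, Subtype.ext_iff.not.mp hij] using congrFun (congrFun h i.1) j.1,
          mul_zero]
      · simp
    cases f
    cases happ
    rfl

/-- The morphism of string modules sending the basis vector at position `a`, which lies in the
top, to the one at position `b`, which lies in the socle, and all others to zero. -/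
theorem exists_entryMap (W W' : Walk Q) (a b : ℕ) (ha : ∀ e i, ¬ W.Step e i a)
    (hb : ∀ e j, ¬ W'.Step e b j) :
    ∃ f : RepHom (StringMod k Q W) (StringMod k Q W'), IsEntryMap W W' a b f := by
  let φ : ∀ v, (W.Pos v → k) →ₗ[k] (W'.Pos v → k) := fun v =>
    { toFun := fun x j => if (j.1 : ℕ) = b then ∑ i, if (i.1 : ℕ) = a then x i else 0 else 0
      map_add' := fun x y => by
        funext j
        simp only [Pi.add_apply]
        split_ifs
        · rw [← Finset.sum_add_distrib]
          refine Finset.sum_congr rfl fun i _ => ?_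
          split_ifs <;> simp
        · simp
      map_smul' := fun c x => by
        funext j
        simp [Finset.mul_sum] }
  refine ⟨⟨φ, fun e => ?_⟩, fun v x j => rfl⟩
  have h : ∀ x, strMap k W' e (φ (Q.s e) x) = φ (Q.t e) (strMap k W e x) := by
    intro x
    funext j
    rw [strMap_apply]
    change _ = if (j.1 : ℕ) = b then ∑ i, if (i.1 : ℕ) = a then strMap k W e x i else 0 else 0
    rw [Finset.sum_eq_zero]
    · symm
      rw [ite_eq_right_iff]
      intro _
      refine Finset.sum_eq_zero fun i _ => ?_
      rw [ite_eq_right_iff]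
      intro hi
      rw [strMap_apply]
      exact Finset.sum_eq_zero fun l _ => if_neg (hi ▸ ha e l.1)
    · intro l _
      rw [ite_eq_right_iff]
      intro hs
      exact if_neg fun hl : (l.1 : ℕ) = b => hb e j.1 (hl ▸ hs)
  exact LinearMap.ext h

theorem IsEntryMap.neZero {W W' : Walk Q} {a b : ℕ}
    {f : RepHom (StringMod k Q W) (StringMod k Q W')} (hf : IsEntryMap W W' a b f)
    (ha : a ≤ W.letters.length) (hb : b ≤ W'.letters.length) (hab : W.vtx a = W'.vtx b) :
    RepHom.NeZero f := by
  let i₀ : W.Pos (W'.vtx b) := ⟨⟨a, by omega⟩, hab⟩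
  let j₀ : W'.Pos (W'.vtx b) := ⟨⟨b, by omega⟩, rfl⟩
  refine ⟨W'.vtx b, (Pi.single i₀ 1 : W.Pos (W'.vtx b) → k), fun h => ?_⟩
  have h' := (hf _ (Pi.single i₀ 1 : W.Pos (W'.vtx b) → k) j₀).symm.trans (congrFun h j₀)
  rw [if_pos rfl, Finset.sum_eq_single i₀, if_pos rfl] at h'
  · exact one_ne_zero ((Pi.single_eq_same (M := fun _ : W.Pos (W'.vtx b) => k) i₀ 1).symm.trans h')
  · intro l _ hl
    refine if_neg fun hla => hl ?_
    exact Subtype.ext (Fin.ext hla)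
  · exact fun h => absurd (Finset.mem_univ _) h

theorem IsEntryMap.not_isIso {W W' : Walk Q} {a b c : ℕ}
    {f : RepHom (StringMod k Q W) (StringMod k Q W')} (hf : IsEntryMap W W' a b f)
    (hc : c ≤ W.letters.length) (hca : c ≠ a) : ¬ f.IsIso := by
  rintro ⟨g, hg, -⟩
  let i₀ : W.Pos (W.vtx c) := ⟨⟨c, by omega⟩, rfl⟩
  have hz : homApp f (W.vtx c) (Pi.single i₀ 1) = 0 := by
    funext j
    refine (hf _ (Pi.single i₀ 1 : W.Pos (W.vtx c) → k) j).trans ?_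
    refine ite_eq_right_iff.mpr fun _ => Finset.sum_eq_zero fun l _ => ?_
    refine ite_eq_right_iff.mpr fun hl => ?_
    refine Pi.single_eq_of_ne (M := fun _ : W.Pos (W.vtx c) => k) (fun h => hca ?_) 1
    rw [← hl, h]
  have h : homApp g (W.vtx c) (homApp f (W.vtx c) (Pi.single i₀ 1)) = Pi.single i₀ 1 :=
    LinearMap.congr_fun (congrFun (congrArg RepHom.app hg) (W.vtx c)) _
  rw [hz, map_zero] at h
  have := congrFun h i₀
  rw [Pi.single_eq_same] at this
  exact zero_ne_one this

end StringModules

section Walks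

open Walk

variable {Q : Quiv}

theorem Walk.ok_of_startV_eq {W : Walk Q}
    (h : ∀ i l, W.letters[i]? = some l → startV Q l = W.vtx i) : W.OK :=
  fun i => h i _ (List.getElem?_eq_getElem i.2)

theorem Walk.reduced_of_ne {W : Walk Q}
    (h : ∀ i e b, W.letters[i]? = some (e, b) → W.letters[i + 1]? ≠ some (e, !b)) : W.Reduced := by
  intro i hi heq
  refine h i (W.letters.get ⟨i, by omega⟩).1 (W.letters.get ⟨i, by omega⟩).2
    (List.getElem?_eq_getElem (by omega)) ?_
  rw [← heq]
  exact List.getElem?_eq_getElem hi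

theorem arrowWalk_ok (a : Q.E) : (arrowWalk Q a).OK := by
  refine ok_of_startV_eq fun i l h => ?_
  simp only [arrowWalk, List.getElem?_singleton] at h
  split_ifs at h with hi
  obtain rfl := Option.some.inj h
  simp [hi, startV, arrowWalk, vtx]

theorem arrowWalk_reduced (a : Q.E) : (arrowWalk Q a).Reduced :=
  reduced_of_ne fun i e b _ => by simp [arrowWalk]

theorem arrowWalk_step (a : Q.E) (e : Q.E) (i j : ℕ) :
    (arrowWalk Q a).Step e i j ↔ i = 0 ∧ j = 1 ∧ e = a := by
  simp only [Step, arrowWalk, List.getElem?_singleton]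
  grind

theorem bigWalk_length (a z : Q.E) (p : List Q.E) :
    (bigWalk Q a z p).letters.length = p.length + 2 := by
  simp [bigWalk]

theorem bigWalk_getElem? (a z : Q.E) (p : List Q.E) (i : ℕ) (l : Q.E × Bool) :
    (bigWalk Q a z p).letters[i]? = some l ↔ (i = 0 ∧ l = (a, false)) ∨
      (∃ q b, p[q]? = some b ∧ i = q + 1 ∧ l = (b, true)) ∨
      (i = p.length + 1 ∧ l = (z, false)) := by
  rcases i with _ | i
  · simp [bigWalk, eq_comm]
  · simp only [bigWalk, List.getElem?_cons_succ, List.getElem?_append, List.length_map,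
      List.getElem?_map, List.getElem?_singleton]
    split_ifs with h h'
    · simp [h]
      grind
    · grind
    · grind

theorem bigWalk_step (a z : Q.E) (p : List Q.E) (e : Q.E) (i j : ℕ) :
    (bigWalk Q a z p).Step e i j ↔ (i = 1 ∧ j = 0 ∧ e = a) ∨
      (∃ q, p[q]? = some e ∧ i = q + 1 ∧ j = q + 2) ∨
      (i = p.length + 2 ∧ j = p.length + 1 ∧ e = z) := by
  simp only [Step, bigWalk_getElem?]
  grind

theorem bigWalk_ok {a z : Q.E} {p : List Q.E} (hp : FromTo Q (Q.s a) (Q.t z) p) :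
    (bigWalk Q a z p).OK := by
  obtain ⟨hchain, hs, ht, hnil⟩ := hp
  have hchain' := List.isChain_iff_getElem.mp hchain
  refine ok_of_startV_eq fun i l h => ?_
  rcases i with _ | i
  · rw [bigWalk_getElem?] at h
    obtain ⟨-, rfl⟩ | ⟨q, b, -, h, -⟩ | ⟨h, -⟩ := h
    · simp [startV, bigWalk, vtx]
    · omega
    · omega
  · have hi : i < (bigWalk Q a z p).letters.length := by
      have := (List.getElem?_eq_some_iff.mp h).1
      omega
    have h' := List.getElem?_eq_getElem hi
    rw [vtx_succ _ h']
    generalize (bigWalk Q a z p).letters[i] = l' at h'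
    rw [bigWalk_getElem?] at h h'
    obtain ⟨h, -⟩ | ⟨q, b, hb, hq, rfl⟩ | ⟨h, rfl⟩ := h
    · omega
    · obtain rfl : i = q := by omega
      obtain ⟨hil, rfl⟩ := List.getElem?_eq_some_iff.mp hb
      obtain ⟨rfl, rfl⟩ | ⟨q', b', hb', rfl, rfl⟩ | ⟨h', rfl⟩ := h'
      · have := hs (List.ne_nil_of_length_pos hil)
        simpa [startV, List.head_eq_getElem] using this
      · obtain ⟨hil', rfl⟩ := List.getElem?_eq_some_iff.mp hb'
        simpa [startV] using (hchain' q' hil).symm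
      · omega
    · obtain ⟨rfl, rfl⟩ | ⟨q', b', hb', rfl, rfl⟩ | ⟨h', rfl⟩ := h'
      · have := hnil (List.length_eq_zero_iff.mp (by omega))
        simpa [startV] using this.symm
      · obtain ⟨hil', rfl⟩ := List.getElem?_eq_some_iff.mp hb'
        have := ht (List.ne_nil_of_length_pos (by omega))
        have hq : p.length - 1 = q' := by omega
        simpa [startV, List.getLast_eq_getElem, hq] using this.symm
      · omega

theorem bigWalk_reduced {a z : Q.E} {p : List Q.E} (ha : p[0]? ≠ some a)
    (hz : p[p.length - 1]? ≠ some z) : (bigWalk Q a z p).Reduced := by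
  refine reduced_of_ne fun i e b h h' => ?_
  rw [bigWalk_getElem?] at h h'
  grind

theorem bigWalk_vtx_last (a z : Q.E) (p : List Q.E) :
    (bigWalk Q a z p).vtx (p.length + 2) = Q.s z := by
  have h : (bigWalk Q a z p).letters[p.length + 1]? = some (z, false) := by
    rw [bigWalk_getElem?]
    simp
  simpa using vtx_succ _ h

variable {k : Type} [Field k]

theorem indecomposable_arrowWalk (a : Q.E) :
    Indecomposable (StringMod k Q (arrowWalk Q a)) := by
  refine indecomposable_of_triangular (arrowWalk_ok a) (arrowWalk_reduced a) (fun i => i)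
    fun f i j hi hj hij hne => ?_
  by_contra hlt
  simp only [arrowWalk, List.length_singleton] at hi hj
  obtain rfl : i = 1 := by omega
  obtain rfl : j = 0 := by omega
  refine hne (coeff_eq_zero_of_not_step_left (arrowWalk_ok a) (arrowWalk_reduced a) f
    ((arrowWalk_step a a 0 1).mpr (by simp)) fun j => ?_)
  simp [arrowWalk_step]

theorem indecomposable_bigWalk_nil {a z : Q.E} (haz : Q.s a = Q.t z) :
    Indecomposable (StringMod k Q (bigWalk Q a z [])) := by
  have hok : (bigWalk Q a z []).OK :=
    bigWalk_ok ⟨List.isChain_nil, by simp [StartsAt], by simp [EndsAt], fun _ => haz⟩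
  have hr : (bigWalk Q a z []).Reduced := bigWalk_reduced (by simp) (by simp)
  refine indecomposable_of_triangular hok hr (fun i => 2 - i) fun f i j hi hj hij hne => ?_
  have hsa : (bigWalk Q a z []).Step a 1 0 := by simp [bigWalk_step]
  have hsz : (bigWalk Q a z []).Step z 2 1 := by simp [bigWalk_step]
  have h12 : coeff f 1 2 = 0 :=
    coeff_eq_zero_of_not_step_left hok hr f hsz (by simp [bigWalk_step])
  have h02 : coeff f 0 2 = 0 :=
    coeff_eq_zero_of_not_step_left hok hr f hsa (by simp [bigWalk_step])
  have h01 : coeff f 0 1 = 0 := by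
    by_cases h : a = z
    · subst h
      rw [← coeff_eq_of_step hok hr f hsa hsz, h12]
    · exact coeff_eq_zero_of_not_step_left hok hr f hsa (by simp [bigWalk_step, h])
  rw [bigWalk_length, List.length_nil] at hi hj
  by_contra hlt
  obtain ⟨rfl, rfl⟩ | ⟨rfl, rfl⟩ | ⟨rfl, rfl⟩ :
      (i = 0 ∧ j = 1) ∨ (i = 0 ∧ j = 2) ∨ (i = 1 ∧ j = 2) := by omega
  exacts [hne h01, hne h02, hne h12]

/-- The endomorphisms of the string module of `a⁻¹ p z⁻¹` are triangular when the positions are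
ordered as `1, p.length + 2, 0, 2, 3, …, p.length + 1`. -/
theorem indecomposable_bigWalk_of_ne_nil {a z : Q.E} {p : List Q.E}
    (hp : FromTo Q (Q.s a) (Q.t z) p) (hnil : p ≠ []) (ha : p[0]? ≠ some a)
    (hz : p[p.length - 1]? ≠ some z) : Indecomposable (StringMod k Q (bigWalk Q a z p)) := by
  have hok := bigWalk_ok hp
  have hr := bigWalk_reduced ha hz
  have hpos := List.length_pos_iff.mpr hnil
  refine indecomposable_of_triangular hok hr
    (fun i => if i = 1 then 0 else if i = p.length + 2 then 1 else if i = 0 then 2 else i + 1)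
    fun f i j hi hj hij hne => ?_
  rw [bigWalk_length] at hi hj
  have hsa : (bigWalk Q a z p).Step a 1 0 := by simp [bigWalk_step]
  have hsp : ∀ q (hq : q < p.length), (bigWalk Q a z p).Step p[q] (q + 1) (q + 2) := by
    intro q hq
    rw [bigWalk_step]
    exact Or.inr (Or.inl ⟨q, List.getElem?_eq_getElem hq, rfl, rfl⟩)
  have hsource : ∀ e i, ¬ (bigWalk Q a z p).Step e i 1 := by
    intro e i
    rw [bigWalk_step]
    rintro (h | ⟨q, h⟩ | h) <;> omega
  have hsource' : ∀ e i, ¬ (bigWalk Q a z p).Step e i (p.length + 2) := by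
    intro e i
    rw [bigWalk_step]
    rintro (h | ⟨q, h, -, hq⟩ | h)
    · omega
    · have := (List.getElem?_eq_some_iff.mp h).1
      omega
    · omega
  have hzero : ∀ {j}, (∀ e i, ¬ (bigWalk Q a z p).Step e i j) → ∀ i, i ≠ 1 → i ≠ p.length + 2 →
      i ≤ p.length + 2 → coeff f i j = 0 := by
    intro j hj i h1 h2 hi
    rcases Nat.eq_zero_or_pos i with rfl | hi0
    · exact coeff_eq_zero_of_not_step_left hok hr f hsa (hj a)
    · obtain ⟨q, rfl⟩ : ∃ q, i = q + 2 := ⟨i - 2, by omega⟩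
      exact coeff_eq_zero_of_not_step_left hok hr f (hsp q (by omega)) (hj _)
  have hlast : coeff f (p.length + 2) 1 = 0 := by
    by_cases h : p[0] = z
    · refine coeff_eq_zero_of_not_step_right hok hr f hsa fun i' => ?_
      rw [bigWalk_step]
      rintro (h' | ⟨q, h', hq, -⟩ | ⟨-, -, rfl⟩)
      · omega
      · have := (List.getElem?_eq_some_iff.mp h').1
        omega
      · exact ha (h ▸ List.getElem?_eq_getElem hpos)
    · refine coeff_eq_zero_of_not_step_right hok hr f (hsp 0 hpos) fun i' => ?_
      rw [bigWalk_step]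
      rintro (h' | ⟨q, h', hq, -⟩ | ⟨-, -, h'⟩)
      · omega
      · have := (List.getElem?_eq_some_iff.mp h').1
        omega
      · exact h h'
  have hmid : ∀ j i, j + 1 < i → i ≤ p.length + 1 → coeff f i (j + 1) = 0 := by
    intro j
    induction j with
    | zero => exact fun i h1 h2 => hzero hsource i (by omega) (by omega) (by omega)
    | succ j ih =>
      intro i h1 h2
      obtain ⟨q, rfl⟩ : ∃ q, i = q + 2 := ⟨i - 2, by omega⟩
      by_cases h : p[j]'(by omega) = p[q]'(by omega)
      · rw [← coeff_eq_of_step hok hr f (hsp q (by omega)) (h ▸ hsp j (by omega))]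
        exact ih _ (by omega) (by omega)
      · refine coeff_eq_zero_of_not_step_left hok hr f (hsp q (by omega)) fun j' => ?_
        rw [bigWalk_step]
        rintro (h' | ⟨q', h', -, hq⟩ | h')
        · omega
        · obtain rfl : j = q' := by omega
          exact h (List.getElem?_eq_some_iff.mp h').2
        · omega
  have hsocle : ∀ q, q < p.length → coeff f (q + 2) 0 = 0 := by
    intro q hq
    by_cases h : p[q] = a
    · have hq0 : q ≠ 0 := by
        rintro rfl
        exact ha (h ▸ List.getElem?_eq_getElem hpos)
      rw [← coeff_eq_of_step hok hr f (h ▸ hsp q hq) hsa]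
      exact hzero hsource _ (by omega) (by omega) (by omega)
    · refine coeff_eq_zero_of_not_step_left hok hr f (hsp q hq) fun j' => ?_
      rw [bigWalk_step]
      rintro (⟨-, -, h'⟩ | ⟨q', h'⟩ | h')
      · exact h h'
      · omega
      · omega
  have hj1 : j ≠ 1 := by
    rintro rfl
    by_cases h : i = p.length + 2
    · exact hne (h ▸ hlast)
    · exact hne (hzero hsource i hij h hi)
  have hj2 : j = p.length + 2 → i = 1 := by
    rintro rfl
    by_contra h
    exact hne (hzero hsource' i h hij hi)
  have hj0 : j = 0 → i = 1 ∨ i = p.length + 2 := by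
    rintro rfl
    by_contra h
    obtain ⟨q, rfl⟩ : ∃ q, i = q + 2 := ⟨i - 2, by omega⟩
    exact hne (hsocle q (by omega))
  have hjm : ¬ (2 ≤ j ∧ j < i ∧ i ≤ p.length + 1) := by
    rintro ⟨h1, h2, h3⟩
    obtain ⟨q, rfl⟩ : ∃ q, j = q + 1 := ⟨j - 1, by omega⟩
    exact hne (hmid q i h2 h3)
  split_ifs <;> omega

end Walks

section Cycle

open Walk

variable {Q : Quiv}

theorem cycPosSrc_le_and_length_pos (u p : List Q.E) (hu : u ≠ []) (n j : ℕ) :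
    cycPosSrc Q p n j ≤ (cycWalk Q u p hu n j).letters.length ∧
      1 ≤ (cycWalk Q u p hu n j).letters.length := by
  unfold cycPosSrc cycWalk
  split_ifs
  · simp [bigWalk_length]
  · simp [arrowWalk]

theorem cycPosTgt_le (u p : List Q.E) (hu : u ≠ []) (n j : ℕ) :
    cycPosTgt Q n j ≤ (cycWalk Q u p hu n (j + 1)).letters.length := by
  unfold cycPosTgt
  have := (cycPosSrc_le_and_length_pos u p hu n (j + 1)).2
  split_ifs <;> omega

theorem not_step_cycPosSrc (u p : List Q.E) (hu : u ≠ []) (n j : ℕ) (e : Q.E) (i : ℕ) :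
    ¬ (cycWalk Q u p hu n j).Step e i (cycPosSrc Q p n j) := by
  unfold cycPosSrc cycWalk
  split_ifs
  · rw [bigWalk_step]
    rintro (h | ⟨q, h, -, hq⟩ | h)
    · omega
    · have := (List.getElem?_eq_some_iff.mp h).1
      omega
    · omega
  · simp [arrowWalk_step]

theorem not_step_cycPosTgt (u p : List Q.E) (hu : u ≠ []) (n j : ℕ) (e : Q.E) (i : ℕ) :
    ¬ (cycWalk Q u p hu n (j + 1)).Step e (cycPosTgt Q n j) i := by
  unfold cycPosTgt cycWalk
  split_ifs
  · simp [bigWalk_step]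
  · simp [arrowWalk_step]

theorem vtx_cycPosSrc {u p : List Q.E} (hu : u ≠ []) (hn : 2 ≤ u.length) (j : ℕ) :
    (cycWalk Q u p hu u.length j).vtx (cycPosSrc Q p u.length j) =
      Q.s (u[u.length - 1 - j % (u.length - 1)]'(by omega)) := by
  unfold cycPosSrc cycWalk
  split_ifs with h
  · simp [h, bigWalk_vtx_last, List.getLast_eq_getElem]
  · rw [List.getD_eq_getElem _ _ (by omega)]
    simp [arrowWalk, vtx]

theorem succ_mod_eq_ite {N : ℕ} (hN : 0 < N) (j : ℕ) :
    (j + 1) % N = if j % N + 1 = N then 0 else j % N + 1 := by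
  have hlt := Nat.mod_lt j hN
  rw [← Nat.mod_add_mod]
  split_ifs with h
  · rw [h, Nat.mod_self]
  · exact Nat.mod_eq_of_lt (by omega)

theorem vtx_cycPosTgt {u p : List Q.E} (hu : u ≠ []) (hchain : IsPath Q u)
    (hn : 2 ≤ u.length) (j : ℕ) :
    (cycWalk Q u p hu u.length (j + 1)).vtx (cycPosTgt Q u.length j) =
      Q.s (u[u.length - 1 - j % (u.length - 1)]'(by omega)) := by
  have hchain' := List.isChain_iff_getElem.mp hchain
  have hlt := Nat.mod_lt j (show 0 < u.length - 1 by omega)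
  have hmod := succ_mod_eq_ite (show 0 < u.length - 1 by omega) j
  unfold cycPosTgt cycWalk
  split_ifs with h
  · have hj : u.length - 1 - j % (u.length - 1) = 0 + 1 := by
      split_ifs at hmod <;> omega
    simp only [hj]
    rw [← hchain' 0 (by omega)]
    simp [bigWalk, vtx, List.head_eq_getElem]
  · have hj : u.length - 1 - j % (u.length - 1) =
        u.length - 1 - (j + 1) % (u.length - 1) + 1 := by
      split_ifs at hmod <;> omega
    simp only [hj]
    rw [← hchain' _ (by omega), List.getD_eq_getElem _ _ (by omega)]
    simp [arrowWalk, vtx, nextV]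

theorem indecomposable_cycWalk {k : Type} [Field k] {R : Set (List Q.E)} {x y : Q.V}
    {u p : List Q.E} (hred : IsReducedBasic Q R x y u p) (hu : u ≠ []) (n j : ℕ) :
    Indecomposable (StringMod k Q (cycWalk Q u p hu n j)) := by
  obtain ⟨-, ⟨-, hux, huy, -⟩, -, hp, hhead, hlast⟩ := hred
  unfold cycWalk
  split_ifs
  · rw [← hux hu, ← huy hu] at hp
    by_cases hnil : p = []
    · subst hnil
      exact indecomposable_bigWalk_nil (hp.2.2.2 rfl)
    · refine indecomposable_bigWalk_of_ne_nil hp hnil ?_ ?_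
      · rw [← List.head?_eq_getElem?, List.head?_eq_some_head hnil]
        exact fun h => hhead hnil hu (Option.some.inj h)
      · rw [← List.getLast?_eq_getElem?, List.getLast?_eq_some_getLast hnil]
        exact fun h => hlast hnil hu (Option.some.inj h)
  · exact indecomposable_arrowWalk _

end Cycle

end Quiv

open Quiv Quiv.Walk in
/-- Each natural morphism in an admissible cycle
`M(α_{n-1}) → ⋯ → M(α₂) → M(α₁⁻¹ p αₙ⁻¹) → M(α_{n-1})` is nonzero and non-invertible,
and all the modules appearing are indecomposable; hence it is a cycle in `mod A`. -/
theorem admissibleCycle_is_cycle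
    (Q : Quiv) (R : Set (List Q.E)) (hR : ∀ l ∈ R, l.length = 2)
    (k : Type) [Field k]
    (x y : Q.V) (u p : List Q.E) (n : ℕ)
    (hred : Q.IsReducedBasic R x y u p)
    (hlen : u.length = n) (hn : 2 ≤ n) :
    ∃ t : ∀ j : ℕ,
        RepHom
          (StringMod k Q (Q.cycWalk u p (List.ne_nil_of_length_pos (by omega)) n j))
          (StringMod k Q
            (Q.cycWalk u p (List.ne_nil_of_length_pos (by omega)) n (j + 1))),
      (∀ j, IsEntryMap _ _ (Q.cycPosSrc p n j) (Q.cycPosTgt n j) (t j)) ∧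
      (∀ j, RepHom.NeZero (t j)) ∧
      (∀ j, ¬ (t j).IsIso) ∧
      (∀ j, Indecomposable
        (StringMod k Q (Q.cycWalk u p (List.ne_nil_of_length_pos (by omega)) n j))) := by
  have hu : u ≠ [] := List.ne_nil_of_length_pos (by omega)
  subst hlen
  choose t ht using fun j => exists_entryMap (k := k)
    (cycWalk Q u p hu u.length j) (cycWalk Q u p hu u.length (j + 1))
    (cycPosSrc Q p u.length j) (cycPosTgt Q u.length j)
    (not_step_cycPosSrc u p hu u.length j) (not_step_cycPosTgt u p hu u.length j)
  refine ⟨t, ht, fun j => ?_, fun j => ?_, fun j => indecomposable_cycWalk hred hu _ j⟩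
  · refine (ht j).neZero (cycPosSrc_le_and_length_pos u p hu _ j).1 (cycPosTgt_le u p hu _ j) ?_
    rw [vtx_cycPosSrc hu hn, vtx_cycPosTgt hu hred.2.1.1 hn]
  · have hpos := cycPosSrc_le_and_length_pos u p hu u.length j
    by_cases h : cycPosSrc Q p u.length j = 0
    · exact (ht j).not_isIso (c := 1) hpos.2 (by omega)
    · exact (ht j).not_isIso (c := 0) (Nat.zero_le _) (by omega)
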